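/- Let G be a strongly connected digraph, let (x,y) be a strong bridge of G, let C be a strongly connected component of G \ (x,y), and let C' be the corresponding digraph in S(G,(x,y)). Let e be an edge of C' with both endpoints in C. Then e is a strong bridge of C' if and only if e is a strong bridge of G. -/

import Mathlib

/-- A directed multigraph: a type `E` of potential edges with source and target
maps, together with the set of edges actually present in the digraph. -/
structure MultiDigraph (V : Type) (E : Type) where
  edges : Set E
  src : E → V
  tgt : E → V

namespace MultiDigraph

variable {V E : Type}

/-- `G.IsWalk u v l` : the list of edges `l` forms a walk from `u` to `v`
(consecutive edges compose). -/
def IsWalk (G : MultiDigraph V E) : V → V → List E → Prop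
  | u, v, [] => u = v
  | u, v, e :: l => e ∈ G.edges ∧ G.src e = u ∧ G.IsWalk (G.tgt e) v l

/-- A path from `u` to `v`: a walk using no edge more than once. -/
def IsTrail (G : MultiDigraph V E) (u v : V) (l : List E) : Prop :=
  G.IsWalk u v l ∧ l.Nodup

/-- `u` reaches `v`: there is a path from `u` to `v`. -/
def Reaches (G : MultiDigraph V E) (u v : V) : Prop :=
  ∃ l : List E, G.IsTrail u v l

/-- `u` and `v` are strongly connected: each reaches the other. -/
def SConn (G : MultiDigraph V E) (u v : V) : Prop :=
  G.Reaches u v ∧ G.Reaches v u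

/-- The digraph is strongly connected. -/
def StronglyConnected (G : MultiDigraph V E) : Prop :=
  ∀ u v : V, G.Reaches u v

/-- Delete the edge `e`. -/
def deleteEdge (G : MultiDigraph V E) (e : E) : MultiDigraph V E :=
  { G with edges := G.edges \ {e} }

/-- A strong bridge: an edge whose deletion destroys strong connectivity. -/
def IsStrongBridge (G : MultiDigraph V E) (e : E) : Prop :=
  e ∈ G.edges ∧ ¬ (G.deleteEdge e).StronglyConnected

end MultiDigraph

namespace MultiDigraph

variable {V E : Type}

/-- `C` is a strongly connected component of `G` (as a set of vertices):
the equivalence class of some vertex under mutual reachability. -/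
def IsSCC (G : MultiDigraph V E) (C : Set V) : Prop :=
  ∃ c : V, C = {w | G.SConn c w}

/-- The digraph `C'` of `S(G,(x,y))` corresponding to the strongly connected
component `C` of `G \ (x,y)`, where `(x,y)` is the strong bridge `e₀`:
it keeps every edge of `G` with both endpoints in `C`, adds one edge `(u,x)`
for every edge `(u,v)` of `G` with `u ∈ C`, `v ∉ C`, one edge `(y,v)` for every
edge `(u,v)` of `G` with `u ∉ C`, `v ∈ C`, and the extra edge `(x,y)`
(represented by `Sum.inr ()`). -/
noncomputable def sOp (G : MultiDigraph V E) (e₀ : E) (C : Set V) :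
    MultiDigraph V (E ⊕ Unit) := by
  classical
  exact
    { edges := Sum.inl '' {e | e ∈ G.edges ∧ (G.src e ∈ C ∨ G.tgt e ∈ C)} ∪
        {Sum.inr ()}
      src := fun p =>
        match p with
        | Sum.inl e => if G.src e ∈ C then G.src e else G.tgt e₀
        | Sum.inr _ => G.src e₀
      tgt := fun p =>
        match p with
        | Sum.inl e => if G.tgt e ∈ C then G.tgt e else G.src e₀
        | Sum.inr _ => G.tgt e₀ }

/-- The digraph `G` is strongly connected when regarded as a digraph with
vertex set `W` : every vertex of `W` reaches every other vertex of `W`. -/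
def SCOn (G : MultiDigraph V E) (W : Set V) : Prop :=
  ∀ a ∈ W, ∀ b ∈ W, G.Reaches a b

end MultiDigraph

namespace MultiDigraph

variable {V E : Type}

/-- There is an edge of `G` from `a` to `b`. -/
def Step (G : MultiDigraph V E) (a b : V) : Prop :=
  ∃ f ∈ G.edges, G.src f = a ∧ G.tgt f = b

theorem IsWalk.of_append_cons {G : MultiDigraph V E} {f : E} {s t : List E} {u v : V}
    (h : G.IsWalk u v (s ++ f :: t)) : G.IsWalk (G.src f) v (f :: t) := by
  induction s generalizing u with
  | nil => exact ⟨h.1, rfl, h.2.2⟩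
  | cons g s ih => exact ih h.2.2

theorem reaches_iff_reflTransGen {G : MultiDigraph V E} {u v : V} :
    G.Reaches u v ↔ Relation.ReflTransGen G.Step u v := by
  constructor
  · rintro ⟨l, hl, -⟩
    induction l generalizing u with
    | nil => exact hl ▸ .refl
    | cons f l ih => exact .head ⟨f, hl.1, hl.2.1, rfl⟩ (ih hl.2.2)
  · intro h
    induction h using Relation.ReflTransGen.head_induction_on with
    | refl => exact ⟨[], rfl, List.nodup_nil⟩
    | head hstep _ ih =>
      obtain ⟨f, hf, rfl, rfl⟩ := hstep
      obtain ⟨l, hl, hnd⟩ := ih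
      by_cases hmem : f ∈ l
      · obtain ⟨s, t, rfl⟩ := List.append_of_mem hmem
        exact ⟨f :: t, hl.of_append_cons, hnd.of_append_right⟩
      · exact ⟨f :: l, ⟨hf, rfl, hl⟩, List.nodup_cons.2 ⟨hmem, hnd⟩⟩

theorem Reaches.refl (G : MultiDigraph V E) (u : V) : G.Reaches u u :=
  ⟨[], rfl, List.nodup_nil⟩

theorem Reaches.trans {G : MultiDigraph V E} {u v w : V} (h : G.Reaches u v)
    (h' : G.Reaches v w) : G.Reaches u w := by
  rw [reaches_iff_reflTransGen] at *
  exact Relation.ReflTransGen.trans h h'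

theorem reaches_of_mem {G : MultiDigraph V E} {f : E} (hf : f ∈ G.edges) :
    G.Reaches (G.src f) (G.tgt f) :=
  reaches_iff_reflTransGen.2 (.single ⟨f, hf, rfl, rfl⟩)

theorem Reaches.head_induction {G : MultiDigraph V E} {w : V} {P : V → Prop} (base : P w)
    (step : ∀ f ∈ G.edges, G.Reaches (G.tgt f) w → P (G.tgt f) → P (G.src f))
    {v : V} (h : G.Reaches v w) : P v := by
  rw [reaches_iff_reflTransGen] at h
  induction h using Relation.ReflTransGen.head_induction_on with
  | refl => exact base
  | head hstep htail ih =>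
    obtain ⟨f, hf, rfl, rfl⟩ := hstep
    exact step f hf (reaches_iff_reflTransGen.2 htail) ih

theorem Reaches.tail_induction {G : MultiDigraph V E} {u : V} {P : V → Prop} (base : P u)
    (step : ∀ f ∈ G.edges, G.Reaches u (G.src f) → P (G.src f) → P (G.tgt f))
    {v : V} (h : G.Reaches u v) : P v := by
  rw [reaches_iff_reflTransGen] at h
  induction h with
  | refl => exact base
  | tail hhead hstep ih =>
    obtain ⟨f, hf, rfl, rfl⟩ := hstep
    exact step f hf (reaches_iff_reflTransGen.2 hhead) ih

theorem reaches_deleteEdge_of_ne {G : MultiDigraph V E} {e f : E} (hf : f ∈ G.edges)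
    (hne : f ≠ e) : (G.deleteEdge e).Reaches (G.src f) (G.tgt f) :=
  reaches_of_mem (G := G.deleteEdge e) ⟨hf, hne⟩

theorem Reaches.deleteEdge_src {G : MultiDigraph V E} {e : E} {v : V}
    (h : G.Reaches v (G.src e)) : (G.deleteEdge e).Reaches v (G.src e) := by
  refine h.head_induction (P := fun v => (G.deleteEdge e).Reaches v (G.src e)) (.refl _ _) ?_
  intro f hf _ ih
  by_cases hfe : f = e
  · exact hfe ▸ .refl _ _
  · exact (reaches_deleteEdge_of_ne hf hfe).trans ih

theorem Reaches.deleteEdge_tgt {G : MultiDigraph V E} {e : E} {v : V}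
    (h : G.Reaches (G.tgt e) v) : (G.deleteEdge e).Reaches (G.tgt e) v := by
  refine h.tail_induction (P := fun v => (G.deleteEdge e).Reaches (G.tgt e) v) (.refl _ _) ?_
  intro f hf _ ih
  by_cases hfe : f = e
  · exact hfe ▸ .refl _ _
  · exact ih.trans (reaches_deleteEdge_of_ne hf hfe)

theorem StronglyConnected.deleteEdge {G : MultiDigraph V E} (hG : G.StronglyConnected) {e : E}
    (h : (G.deleteEdge e).Reaches (G.src e) (G.tgt e)) :
    (G.deleteEdge e).StronglyConnected := fun u v =>
  ((hG u _).deleteEdge_src.trans h).trans (hG _ v).deleteEdge_tgt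

/-- A vertex that cannot reach `src e` in `G \ e₀` keeps its reachability when `e` replaces `e₀`
as the deleted edge. -/
theorem Reaches.deleteEdge_of_not_reaches_src {G : MultiDigraph V E} {e e₀ : E} {v w : V}
    (h : (G.deleteEdge e₀).Reaches v w) (hv : ¬ (G.deleteEdge e₀).Reaches v (G.src e)) :
    (G.deleteEdge e).Reaches v w := by
  revert hv
  refine h.head_induction (P := fun v => ¬ (G.deleteEdge e₀).Reaches v (G.src e) →
    (G.deleteEdge e).Reaches v w) (fun _ => .refl _ _) ?_
  intro f hf _ ih hv
  have hfe : f ≠ e := by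
    rintro rfl
    exact hv (.refl _ _)
  exact (reaches_deleteEdge_of_ne hf.1 hfe).trans
    (ih fun hr => hv ((reaches_of_mem hf).trans hr))

theorem Reaches.deleteEdge_of_not_reaches_tgt {G : MultiDigraph V E} {e e₀ : E} {v w : V}
    (h : (G.deleteEdge e₀).Reaches w v) (hv : ¬ (G.deleteEdge e₀).Reaches (G.tgt e) v) :
    (G.deleteEdge e).Reaches w v := by
  revert hv
  refine h.tail_induction (P := fun v => ¬ (G.deleteEdge e₀).Reaches (G.tgt e) v →
    (G.deleteEdge e).Reaches w v) (fun _ => .refl _ _) ?_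
  intro f hf _ ih hv
  have hfe : f ≠ e := by
    rintro rfl
    exact hv (.refl _ _)
  exact (ih fun hr => hv (hr.trans (reaches_of_mem hf))).trans
    (reaches_deleteEdge_of_ne hf.1 hfe)

theorem IsSCC.reaches {G : MultiDigraph V E} {C : Set V} (hC : G.IsSCC C) {a b : V}
    (ha : a ∈ C) (hb : b ∈ C) : G.Reaches a b := by
  obtain ⟨c, rfl⟩ := hC
  exact ha.2.trans hb.1

theorem IsSCC.mem_of_reaches {G : MultiDigraph V E} {C : Set V} (hC : G.IsSCC C) {a b v : V}
    (ha : a ∈ C) (hb : b ∈ C) (hav : G.Reaches a v) (hvb : G.Reaches v b) : v ∈ C := by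
  obtain ⟨c, rfl⟩ := hC
  exact ⟨ha.1.trans hav, hvb.trans hb.2⟩

section SOp

variable {G : MultiDigraph V E} {e₀ e : E} {C : Set V}

theorem inl_mem_sOp_edges {f : E} :
    Sum.inl f ∈ (G.sOp e₀ C).edges ↔ f ∈ G.edges ∧ (G.src f ∈ C ∨ G.tgt f ∈ C) := by
  simp [sOp, and_or_left]

theorem inr_mem_sOp_edges : Sum.inr () ∈ (G.sOp e₀ C).edges := by
  simp [sOp]

open Classical in
theorem sOp_src_inl {f : E} :
    (G.sOp e₀ C).src (Sum.inl f) = if G.src f ∈ C then G.src f else G.tgt e₀ := rfl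

open Classical in
theorem sOp_tgt_inl {f : E} :
    (G.sOp e₀ C).tgt (Sum.inl f) = if G.tgt f ∈ C then G.tgt f else G.src e₀ := rfl

theorem sOp_deleteEdge_reaches_inl {f : E} (hf : f ∈ (G.deleteEdge e).edges)
    (hC : G.src f ∈ C ∨ G.tgt f ∈ C) :
    ((G.sOp e₀ C).deleteEdge (Sum.inl e)).Reaches
      ((G.sOp e₀ C).src (Sum.inl f)) ((G.sOp e₀ C).tgt (Sum.inl f)) :=
  reaches_deleteEdge_of_ne (inl_mem_sOp_edges.2 ⟨hf.1, hC⟩) fun h => hf.2 (Sum.inl_injective h)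

theorem sOp_deleteEdge_reaches_bridge :
    ((G.sOp e₀ C).deleteEdge (Sum.inl e)).Reaches (G.src e₀) (G.tgt e₀) :=
  reaches_deleteEdge_of_ne (G := G.sOp e₀ C) inr_mem_sOp_edges Sum.inr_ne_inl

open Classical in
/-- A path of `G \ e` ending in `C` projects to `C' \ e`, vertices outside `C` going to the head
of `e₀`. -/
theorem Reaches.sOp_deleteEdge {a b : V} (h : (G.deleteEdge e).Reaches a b) (hb : b ∈ C) :
    ((G.sOp e₀ C).deleteEdge (Sum.inl e)).Reaches (if a ∈ C then a else G.tgt e₀) b := by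
  refine h.head_induction (P := fun a => ((G.sOp e₀ C).deleteEdge (Sum.inl e)).Reaches
    (if a ∈ C then a else G.tgt e₀) b) ?_ ?_
  · rw [if_pos hb]
    exact .refl _ _
  · intro f hf _ ih
    change Reaches _ (if G.tgt f ∈ C then _ else _) b at ih
    change Reaches _ (if G.src f ∈ C then _ else _) b
    by_cases hfC : G.src f ∈ C ∨ G.tgt f ∈ C
    · have hstep := sOp_deleteEdge_reaches_inl (e₀ := e₀) hf hfC
      rw [sOp_src_inl, sOp_tgt_inl] at hstep
      refine hstep.trans ?_
      split_ifs at ih ⊢ with ht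
      · exact ih
      · exact sOp_deleteEdge_reaches_bridge.trans ih
    · rw [not_or] at hfC
      rw [if_neg hfC.2] at ih
      rwa [if_neg hfC.1]

/-- A path of `G \ e` from `C` to a vertex outside `C` leaves `C`, so that `C' \ e` has a path to
the tail of `e₀`. -/
theorem Reaches.sOp_deleteEdge_src {a b : V} (h : (G.deleteEdge e).Reaches a b) (ha : a ∈ C)
    (hb : b ∉ C) : ((G.sOp e₀ C).deleteEdge (Sum.inl e)).Reaches a (G.src e₀) := by
  revert ha
  refine h.head_induction (P := fun a => a ∈ C →
    ((G.sOp e₀ C).deleteEdge (Sum.inl e)).Reaches a (G.src e₀)) (fun hbC => absurd hbC hb) ?_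
  intro f hf _ ih hfC
  have hstep := sOp_deleteEdge_reaches_inl (e₀ := e₀) hf (Or.inl hfC)
  rw [sOp_src_inl, sOp_tgt_inl] at hstep
  change G.src f ∈ C at hfC
  change G.tgt f ∈ C → Reaches _ (G.tgt f) _ at ih
  change Reaches _ (G.src f) _
  rw [if_pos hfC] at hstep
  split_ifs at hstep with ht
  · exact hstep.trans (ih ht)
  · exact hstep

theorem SCOn.sOp_deleteEdge (h : (G.deleteEdge e).StronglyConnected) (hC : C.Nonempty) :
    ((G.sOp e₀ C).deleteEdge (Sum.inl e)).SCOn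
      (insert (G.src e₀) (insert (G.tgt e₀) C)) := by
  obtain ⟨c, hc⟩ := hC
  have hCC : ∀ a ∈ C, ((G.sOp e₀ C).deleteEdge (Sum.inl e)).Reaches a c := fun a ha => by
    simpa [ha] using (h a c).sOp_deleteEdge (e₀ := e₀) hc
  have hCC' : ∀ b ∈ C, ((G.sOp e₀ C).deleteEdge (Sum.inl e)).Reaches c b := fun b hb => by
    simpa [hc] using (h c b).sOp_deleteEdge (e₀ := e₀) hb
  have hy : ((G.sOp e₀ C).deleteEdge (Sum.inl e)).Reaches (G.tgt e₀) c := by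
    simpa using (h (G.tgt e₀) c).sOp_deleteEdge (e₀ := e₀) hc
  have hx : ((G.sOp e₀ C).deleteEdge (Sum.inl e)).Reaches c (G.src e₀) := by
    by_cases hxC : G.src e₀ ∈ C
    · exact hCC' _ hxC
    · exact (h c _).sOp_deleteEdge_src hc hxC
  intro a ha b hb
  have hac : ((G.sOp e₀ C).deleteEdge (Sum.inl e)).Reaches a c := by
    rcases ha with rfl | rfl | ha
    · exact sOp_deleteEdge_reaches_bridge.trans hy
    · exact hy
    · exact hCC a ha
  refine hac.trans ?_
  rcases hb with rfl | rfl | hb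
  · exact hx
  · exact hx.trans sOp_deleteEdge_reaches_bridge
  · exact hCC' b hb

/-- A path of `C' \ e` lifts to `G \ e`. -/
theorem Reaches.of_sOp_deleteEdge (hG : G.StronglyConnected) (he₀ : e₀ ∈ G.edges)
    (hC : (G.deleteEdge e₀).IsSCC C) (hs : G.src e ∈ C) (ht : G.tgt e ∈ C) (hne : e₀ ≠ e)
    {a b : V} (h : ((G.sOp e₀ C).deleteEdge (Sum.inl e)).Reaches a b) :
    (G.deleteEdge e).Reaches a b := by
  refine h.head_induction (P := fun a => (G.deleteEdge e).Reaches a b) (.refl _ _) ?_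
  rintro (f | ⟨⟩) hf _ ih
  · refine Reaches.trans ?_ ih
    change Reaches _ ((G.sOp e₀ C).src (Sum.inl f)) ((G.sOp e₀ C).tgt (Sum.inl f))
    have hfe : f ≠ e := fun hfe => hf.2 (congrArg Sum.inl hfe)
    obtain ⟨hfG, hfC⟩ := inl_mem_sOp_edges.1 hf.1
    have hstep := reaches_deleteEdge_of_ne hfG hfe
    rw [sOp_src_inl, sOp_tgt_inl]
    split_ifs with hsC htC htC
    · exact hstep
    · by_cases hf₀ : f = e₀
      · exact hf₀ ▸ .refl _ _
      · refine hstep.trans ((hG _ _).deleteEdge_src.deleteEdge_of_not_reaches_src fun hr => htC ?_)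
        exact hC.mem_of_reaches hsC hs (reaches_deleteEdge_of_ne hfG hf₀) hr
    · by_cases hf₀ : f = e₀
      · exact hf₀ ▸ .refl _ _
      · refine Reaches.trans
          ((hG _ _).deleteEdge_tgt.deleteEdge_of_not_reaches_tgt fun hr => hsC ?_) hstep
        exact hC.mem_of_reaches ht htC hr (reaches_deleteEdge_of_ne hfG hf₀)
    · exact absurd hfC (by simp [hsC, htC])
  · exact (reaches_deleteEdge_of_ne he₀ hne).trans ih

end SOp

end MultiDigraph

/-- Let `e₀ = (x,y)` be a strong bridge of the strongly
connected digraph `G`, let `C` be a strongly connected component of `G \ e₀`,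
and let `C'` be the corresponding digraph of `S(G,e₀)`. An edge `e` of `C'`
with both endpoints in `C` is a strong bridge of `C'` iff `e` is a strong
bridge of `G`. -/
theorem statement_13 {V E : Type} (G : MultiDigraph V E)
    (hG : G.StronglyConnected) (e₀ : E) (hbr : G.IsStrongBridge e₀)
    (C : Set V) (hC : (G.deleteEdge e₀).IsSCC C)
    (e : E) (he : e ∈ G.edges) (hs : G.src e ∈ C) (ht : G.tgt e ∈ C) :
    (Sum.inl e ∈ (G.sOp e₀ C).edges ∧
        ¬ ((G.sOp e₀ C).deleteEdge (Sum.inl e)).SCOn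
          (insert (G.src e₀) (insert (G.tgt e₀) C))) ↔
      G.IsStrongBridge e := by
  have hmem : Sum.inl e ∈ (G.sOp e₀ C).edges :=
    MultiDigraph.inl_mem_sOp_edges.2 ⟨he, Or.inl hs⟩
  simp only [MultiDigraph.IsStrongBridge, hmem, he, true_and, not_iff_not]
  constructor
  · intro h
    have hne : e₀ ≠ e := by
      rintro rfl
      exact hbr.2 (hG.deleteEdge (hC.reaches hs ht))
    refine hG.deleteEdge (MultiDigraph.Reaches.of_sOp_deleteEdge hG hbr.1 hC hs ht hne ?_)
    exact h _ (Or.inr (Or.inr hs)) _ (Or.inr (Or.inr ht))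
  · exact fun h => MultiDigraph.SCOn.sOp_deleteEdge h ⟨_, hs⟩
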